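/- arXiv:1607.04742 — 2 statements merged into one kernel-verified Lean document; each statement's English description precedes it below -/
import Mathlib

section
/- The Gauss hypergeometric series satisfies ₂F₁(1/3, 1/2; 1; 1/5) = (3/20) · 2^{2/3} · √5 · Γ(1/3)³ / π², where Γ denotes the Gamma function. -/
open scoped Nat

/-- Pochhammer symbol (rising factorial) on the reals. -/
noncomputable def poch (a : ℝ) (n : ℕ) : ℝ := ∏ i ∈ Finset.range n, (a + i)

/-- Gauss hypergeometric series ₂F₁(a,b;c;x) as a real series. -/
noncomputable def twoFone (a b c x : ℝ) : ℝ :=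
  ∑' n : ℕ, poch a n * poch b n / (poch c n * (n ! : ℝ)) * x ^ n

open MeasureTheory Set

lemma cov_image {a b : ℝ} (hab : a < b) {g g' : ℝ → ℝ} (hc : ContinuousOn g (Icc a b))
    (hd : ∀ x ∈ Ioo a b, HasDerivAt g (g' x) x) (hp : ∀ x ∈ Ioo a b, 0 < g' x) :
    StrictMonoOn g (Icc a b) ∧ g '' Ioo a b = Ioo (g a) (g b) := by
  have hm : StrictMonoOn g (Icc a b) := by
    apply strictMonoOn_of_deriv_pos (convex_Icc a b) hc
    intro x hx
    rw [interior_Icc] at hx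
    rw [(hd x hx).deriv]; exact hp x hx
  refine ⟨hm, Subset.antisymm ?_ (intermediate_value_Ioo hab.le hc)⟩
  rintro _ ⟨x, hx, rfl⟩
  exact ⟨hm (left_mem_Icc.2 hab.le) (Ioo_subset_Icc_self hx) hx.1,
    hm (Ioo_subset_Icc_self hx) (right_mem_Icc.2 hab.le) hx.2⟩

lemma cov {a b : ℝ} (hab : a < b) {g g' : ℝ → ℝ} (hc : ContinuousOn g (Icc a b))
    (hd : ∀ x ∈ Ioo a b, HasDerivAt g (g' x) x) (hp : ∀ x ∈ Ioo a b, 0 < g' x)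
    {f h : ℝ → ℝ} (hf : ∀ x ∈ Ioo a b, g' x * f (g x) = h x) :
    (∫ x in Ioo (g a) (g b), f x = ∫ x in Ioo a b, h x) ∧
    (IntegrableOn f (Ioo (g a) (g b)) ↔ IntegrableOn h (Ioo a b)) := by
  obtain ⟨hm, hi⟩ := cov_image hab hc hd hp
  have hinj : InjOn g (Ioo a b) := (hm.mono Ioo_subset_Icc_self).injOn
  have hd' : ∀ x ∈ Ioo a b, HasDerivWithinAt g (g' x) (Ioo a b) x :=
    fun x hx => (hd x hx).hasDerivWithinAt
  have e : EqOn (fun x => |g' x| • f (g x)) h (Ioo a b) := by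
    intro x hx
    simp only [smul_eq_mul, abs_of_pos (hp x hx)]
    exact hf x hx
  constructor
  · rw [← hi, integral_image_eq_integral_abs_deriv_smul measurableSet_Ioo hd' hinj]
    exact setIntegral_congr_fun measurableSet_Ioo e
  · rw [← hi, integrableOn_image_iff_integrableOn_abs_deriv_smul measurableSet_Ioo hd' hinj]
    exact integrableOn_congr_fun e measurableSet_Ioo

lemma sqrt_swap {G n A B : ℝ} (hG : 0 < G) (hn : 0 < n) (hA : 0 < A) (hB : 0 < B)
    (h : G ^ 2 * B = n ^ 2 * A) : G * (√A)⁻¹ = n * (√B)⁻¹ := by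
  have h1 : G * √B = n * √A := by
    have := congrArg Real.sqrt h
    rwa [Real.sqrt_mul (sq_nonneg _), Real.sqrt_mul (sq_nonneg _), Real.sqrt_sq hG.le,
      Real.sqrt_sq hn.le] at this
  have := Real.sqrt_pos.2 hA
  have := Real.sqrt_pos.2 hB
  field_simp
  linarith

lemma choose_poch (a : ℝ) (n : ℕ) : Ring.choose (a + n - 1) n = poch a n / n ! := by
  have h1 : Ring.choose (a + n - 1) n = Ring.multichoose a n := by
    rw [Ring.choose]; congr 1; ring
  have h2 := Ring.factorial_nsmul_multichoose_eq_ascPochhammer a n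
  have h3 : (ascPochhammer ℕ n).smeval a = poch a n := by
    clear h1 h2
    induction n with
    | zero => simp [poch]
    | succ k ih =>
      rw [ascPochhammer_succ_right, Polynomial.smeval_mul, ih, poch, poch, Finset.prod_range_succ]
      simp [Polynomial.smeval_add, Polynomial.smeval_natCast]
  rw [h1, eq_div_iff (by positivity), ← h3, ← h2]
  simp [mul_comm]

lemma binom_hasSum (a x : ℝ) (hx : |x| < 1) :
    HasSum (fun n : ℕ => poch a n / n ! * x ^ n) (((1 - x) ^ a)⁻¹) := by
  have h := (Real.one_div_one_sub_rpow_hasFPowerSeriesOnBall_zero a).hasSum (y := x) (by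
    simp only [Metric.mem_eball, edist_zero_right]
    rw [← ofReal_norm, Real.norm_eq_abs]
    rw [ENNReal.ofReal_lt_one]; exact hx)
  simp only [zero_add, one_div] at h
  have e : (fun n : ℕ => poch a n / n ! * x ^ n) = fun n =>
      (FormalMultilinearSeries.ofScalars ℝ (fun n : ℕ => Ring.choose (a + n - 1) n) n)
        fun _ => x := by
    ext n
    simp [choose_poch]
    ring
  rw [e]
  exact h

lemma cos_int (n : ℕ) : ∫ θ in (0:ℝ)..Real.pi/2, Real.cos θ ^ (2*n) =
    Real.pi / 2 * (poch (1/2) n / poch 1 n) := by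
  rw [EulerSine.integral_cos_pow_eq, integral_sin_pow_even, poch, poch, ← Finset.prod_div_distrib]
  have : ∏ i ∈ Finset.range n, (2 * (i:ℝ) + 1) / (2 * i + 2) =
    ∏ i ∈ Finset.range n, (1/2 + (i:ℝ)) / (1 + i) := by
    apply Finset.prod_congr rfl
    intro i _
    field_simp
    ring
  rw [this]; ring

lemma poch_nonneg {a : ℝ} (ha : 0 ≤ a) (n : ℕ) : 0 ≤ poch a n :=
  Finset.prod_nonneg fun i _ => by positivity

lemma series_int : twoFone (1/3) (1/2) 1 (1/5) =
    2 / Real.pi * ∫ θ in Ioo (0:ℝ) (Real.pi/2), ((1 - Real.cos θ ^ 2 / 5) ^ (1/3:ℝ))⁻¹ := by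
  have key : HasSum (fun n : ℕ => ∫ θ in (0:ℝ)..Real.pi/2,
      poch (1/3) n / n ! * (Real.cos θ ^ 2 / 5) ^ n)
      (∫ θ in (0:ℝ)..Real.pi/2, ((1 - Real.cos θ ^ 2 / 5) ^ (1/3:ℝ))⁻¹) := by
    apply intervalIntegral.hasSum_integral_of_dominated_convergence
      (fun n _ => poch (1/3) n / n ! * (1/5) ^ n)
    · intro n
      exact Continuous.aestronglyMeasurable (by fun_prop)
    · intro n
      refine Filter.Eventually.of_forall fun θ _ => ?_
      have h0 := poch_nonneg (a := 1/3) (by norm_num) n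
      have h1 := Real.cos_sq_le_one θ
      rw [Real.norm_eq_abs, abs_of_nonneg (by positivity)]
      gcongr
    · refine Filter.Eventually.of_forall fun θ _ => ?_
      exact (binom_hasSum (1/3) (1/5) (by norm_num [abs_of_pos])).summable
    · simp
    · refine Filter.Eventually.of_forall fun θ _ => ?_
      apply binom_hasSum
      have h1 := Real.cos_sq_le_one θ
      rw [abs_of_nonneg (by positivity)]
      linarith
  rw [intervalIntegral.integral_of_le (by positivity), integral_Ioc_eq_integral_Ioo] at key
  rw [← key.tsum_eq, ← tsum_mul_left, twoFone]
  congr 1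
  ext n
  have : (fun θ => poch (1/3) n / n ! * (Real.cos θ ^ 2 / 5) ^ n) =
    fun θ => (poch (1/3) n / n ! * (1/5)^n) * Real.cos θ ^ (2*n) := by
    ext θ; rw [div_pow, ← pow_mul, one_div_pow]; ring
  rw [this, intervalIntegral.integral_const_mul, cos_int]
  have := Real.pi_pos
  field_simp

lemma beta_int : ∫ t in Ioo (0:ℝ) 1, t ^ (-5/6:ℝ) * (1 - t) ^ (-1/2:ℝ) =
    (2:ℝ) ^ ((2:ℝ)/3) * 3 * Real.Gamma (1/3) ^ 3 / (4 * Real.pi) := by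
  have h := Complex.betaIntegral_eq_Gamma_mul_div ((1/6:ℝ):ℂ) ((1/2:ℝ):ℂ) (by simp) (by simp)
  have e : Complex.betaIntegral ((1/6:ℝ):ℂ) ((1/2:ℝ):ℂ) =
      ((∫ t in Ioo (0:ℝ) 1, t ^ (-5/6:ℝ) * (1 - t) ^ (-1/2:ℝ) : ℝ) : ℂ) := by
    rw [Complex.betaIntegral, intervalIntegral.integral_of_le zero_le_one,
      integral_Ioc_eq_integral_Ioo, ← integral_complex_ofReal]
    apply setIntegral_congr_fun measurableSet_Ioo
    intro t ht
    simp only [Complex.ofReal_mul]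
    rw [Complex.ofReal_cpow ht.1.le, Complex.ofReal_cpow (by linarith [ht.2])]
    congr 2 <;> push_cast <;> norm_num
  rw [e, ← Complex.ofReal_add, Complex.Gamma_ofReal, Complex.Gamma_ofReal, Complex.Gamma_ofReal] at h
  rw [← Complex.ofReal_mul, ← Complex.ofReal_div, Complex.ofReal_inj] at h
  rw [h]
  have d := Real.Gamma_mul_Gamma_add_half (1/6)
  have r := Real.Gamma_mul_Gamma_one_sub (1/3)
  rw [show Real.pi * (1/3) = Real.pi / 3 by ring, Real.sin_pi_div_three] at r
  norm_num at d r
  have g1 : 0 < Real.Gamma (1/3) := Real.Gamma_pos_of_pos (by norm_num)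
  have g2 : 0 < Real.Gamma (2/3) := Real.Gamma_pos_of_pos (by norm_num)
  rw [Real.Gamma_one_half_eq]
  have hp := Real.pi_pos
  have hsp : √Real.pi ^ 2 = Real.pi := Real.sq_sqrt hp.le
  have hs3 : √(3:ℝ) ^ 2 = 3 := Real.sq_sqrt (by norm_num)
  have h3 : 0 < √(3:ℝ) := by positivity
  norm_num
  set p := (2:ℝ) ^ (2/3:ℝ)
  have r' : Real.Gamma (1/3) * Real.Gamma (2/3) * √3 = 2 * Real.pi := by
    rw [r]; field_simp
  have r2 : Real.Gamma (1/3)^2 * Real.Gamma (2/3)^2 * 3 = 4 * Real.pi^2 := by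
    linear_combination (Real.Gamma (1/3) * Real.Gamma (2/3) * √3 + 2 * Real.pi) * r' - Real.Gamma (1/3)^2 * Real.Gamma (2/3)^2 * hs3
  have d' : Real.Gamma (1/6) = Real.Gamma (1/3) * p * √Real.pi / Real.Gamma (2/3) := by
    rw [eq_div_iff g2.ne', d]
  rw [d', div_mul_eq_mul_div, div_div, div_eq_div_iff (by positivity) (by positivity)]
  linear_combination (4 * Real.pi * Real.Gamma (1/3) * p) * hsp - Real.Gamma (1/3) * p * r2

noncomputable def qd (r y : ℝ) : ℝ := 1 + (-7/2+3/2*r)*y + (11/2-123/50*r)*y^2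
noncomputable def qd1 (r y : ℝ) : ℝ := (-7/2+3/2*r) + 2*(11/2-123/50*r)*y
noncomputable def qP (r y : ℝ) : ℝ := 1/5 + (-2+3/5*r)*y + (21/2-51/10*r)*y^2
  + (-329/10+147/10*r)*y^3 + (377/10-843/50*r)*y^4
noncomputable def qP1 (r y : ℝ) : ℝ := (-2+3/5*r) + 2*(21/2-51/10*r)*y
  + 3*(-329/10+147/10*r)*y^2 + 4*(377/10-843/50*r)*y^3
noncomputable def qM (r y : ℝ) : ℝ := (qd r y + 2*y*qd1 r y) * qP r y + y * qd r y * (- qP1 r y)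
noncomputable def qC (r : ℝ) : ℝ := (9*r-20)/10
noncomputable def qf (r y : ℝ) : ℝ := 1 - 9*y - 6*qC r*y^2 - (qC r)^2*y^3

lemma q_ident (r y : ℝ) (hr : r^2 = 5) :
    (qM r y)^2 * qf r y = 5 * (qP r y)^3 - 25/4 * y^3 * (qd r y)^6 := by
  unfold qM qf qC qd qd1 qP qP1
  linear_combination (
    (9/20)*y^2*r^0 + (-1647/125)*y^3*r^0 + (54/25)*y^3*r^1 + (84807/500)*y^4*r^0 +
    (-154467/2500)*y^4*r^1 + (81/25)*y^4*r^2 + (-2591811/2000)*y^5*r^0 +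
    (18767619/25000)*y^5*r^1 + (-966897/10000)*y^5*r^2 + (532809/80)*y^6*r^0 +
    (-66260727/12500)*y^6*r^1 + (277287543/250000)*y^6*r^2 + (-50301/2500)*y^6*r^3 +
    (-39745539/1600)*y^7*r^0 + (1229178321/50000)*y^7*r^1 + (-6763535721/1000000)*y^7*r^2 +
    (79240113/250000)*y^7*r^3 + (-6561/2500)*y^7*r^4 + (564995493/8000)*y^8*r^0 +
    (-15602988609/200000)*y^8*r^1 + (4982987079/200000)*y^8*r^2 + (-9718079571/5000000)*y^8*r^3
    + (4940433/125000)*y^8*r^4 + (-4824717453/32000)*y^9*r^0 + (67212069273/400000)*y^9*r^1 +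
    (-57265916301/1000000)*y^9*r^2 + (59088718107/10000000)*y^9*r^3 +
    (-18736684371/100000000)*y^9*r^4 + (3419146107/16000)*y^10*r^0 +
    (-45471444741/200000)*y^10*r^1 + (94858907139/1250000)*y^10*r^2 +
    (-8168138091/1000000)*y^10*r^3 + (13153166937/50000000)*y^10*r^4 +
    (-4595451579/32000)*y^11*r^0 + (53319043881/400000)*y^11*r^1 +
    (-151067138157/5000000)*y^11*r^2 + (-78988468761/50000000)*y^11*r^3 +
    (57099370419/100000000)*y^11*r^4 + (-168362361/4000)*y^12*r^0 +
    (19420345161/200000)*y^12*r^1 + (-74105597277/1000000)*y^12*r^2 +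
    (576994797927/25000000)*y^12*r^3 + (-312737005809/125000000)*y^12*r^4 +
    (771751017/6400)*y^13*r^0 + (-79936085493/400000)*y^13*r^1 +
    (617057551341/5000000)*y^13*r^2 + (-336206756943/10000000)*y^13*r^3 +
    (1702064726127/500000000)*y^13*r^4 + (-757787481/16000)*y^14*r^0 +
    (16973360541/200000)*y^14*r^1 + (-142566783183/2500000)*y^14*r^2 +
    (85154022711/5000000)*y^14*r^3 + (-476828392923/250000000)*y^14*r^4 +
    (-6578649/32000)*y^15*r^0 + (147232107/400000)*y^15*r^1 + (-617830497/2500000)*y^15*r^2 +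
    (737451297/10000000)*y^15*r^3 + (-4126086783/500000000)*y^15*r^4) * hr

lemma q_pos (r y : ℝ) (h1 : 2.2360679 < r) (h2 : r < 2.2360680) (hy0 : 0 ≤ y) (hy : y ≤ 1/9) :
    0 < qd r y ∧ 0 < qP r y ∧ 0 < qM r y := by
  have y2 : y^2 ≤ (1/9)^2 := by gcongr
  have y3 : y^3 ≤ (1/9)^3 := by gcongr
  have y4 : y^4 ≤ (1/9)^4 := by gcongr
  have z2 : 0 ≤ y^2 := by positivity
  have z3 : 0 ≤ y^3 := by positivity
  have z4 : 0 ≤ y^4 := by positivity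
  have hd : 0 < qd r y := by
    unfold qd
    have a1 := mul_le_mul_of_nonneg_right (show (-1/5:ℝ) ≤ -7/2+3/2*r by linarith) hy0
    have a2 := mul_le_mul_of_nonneg_right (show (-1/5:ℝ) ≤ 11/2-123/50*r by linarith) z2
    linarith
  have hP : 0 < qP r y := by
    unfold qP
    have a1 := mul_le_mul_of_nonneg_right (show (-7/10:ℝ) ≤ -2+3/5*r by linarith) hy0
    have a2 := mul_le_mul_of_nonneg_right (show (-1:ℝ) ≤ 21/2-51/10*r by linarith) z2
    have a3 := mul_le_mul_of_nonneg_right (show (-1:ℝ) ≤ -329/10+147/10*r by linarith) z3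
    have a4 := mul_le_mul_of_nonneg_right (show (-1:ℝ) ≤ 377/10-843/50*r by linarith) z4
    linarith
  have hP1 : 0 ≤ - qP1 r y := by
    unfold qP1
    have a2 := mul_le_mul_of_nonneg_right (show 21/2-51/10*r ≤ (0:ℝ) by linarith) hy0
    have a3 := mul_le_mul_of_nonneg_right (show -329/10+147/10*r ≤ (0:ℝ) by linarith) z2
    have a4 := mul_le_mul_of_nonneg_right (show 377/10-843/50*r ≤ (0:ℝ) by linarith) z3
    linarith
  have hd1 : 0 < qd r y + 2*y*qd1 r y := by
    unfold qd qd1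
    have a1 := mul_le_mul_of_nonneg_right (show (-1/5:ℝ) ≤ -7/2+3/2*r by linarith) hy0
    have a2 := mul_le_mul_of_nonneg_right (show (-1/5:ℝ) ≤ 11/2-123/50*r by linarith) z2
    linarith
  refine ⟨hd, hP, ?_⟩
  unfold qM
  have := mul_pos hd1 hP
  have := mul_nonneg (mul_nonneg hy0 hd.le) hP1
  linarith

lemma hasDerivAt_qd (r y : ℝ) : HasDerivAt (qd r) (qd1 r y) y := by
  have h := (((hasDerivAt_id y).const_mul (-7/2+3/2*r)).const_add 1).add
    (((hasDerivAt_id y).pow 2).const_mul (11/2-123/50*r))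
  refine (h.congr_deriv ?_).congr_of_eventuallyEq ?_
  · simp [qd1]; ring
  · exact Filter.Eventually.of_forall fun x => by simp [qd]

lemma hasDerivAt_qP (r y : ℝ) : HasDerivAt (qP r) (qP1 r y) y := by
  have h := (((((hasDerivAt_id y).const_mul (-2+3/5*r)).const_add (1/5)).add
    (((hasDerivAt_id y).pow 2).const_mul (21/2-51/10*r))).add
    (((hasDerivAt_id y).pow 3).const_mul (-329/10+147/10*r))).add
    (((hasDerivAt_id y).pow 4).const_mul (377/10-843/50*r))
  refine (h.congr_deriv ?_).congr_of_eventuallyEq ?_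
  · simp [qP1]; ring
  · exact Filter.Eventually.of_forall fun x => by simp [qP]

lemma hasDerivAt_qZ (r y : ℝ) (hP : qP r y ≠ 0) :
    HasDerivAt (fun y => y * (qd r y)^2 / qP r y) (qd r y * qM r y / (qP r y)^2) y := by
  have h := ((hasDerivAt_id y).mul ((hasDerivAt_qd r y).pow 2)).div (hasDerivAt_qP r y) hP
  refine (h.congr_deriv ?_).congr_of_eventuallyEq ?_
  · simp [qM]; ring
  · exact Filter.Eventually.of_forall fun x => by simp

lemma sqrt5_bounds : (2.2360679:ℝ) < √5 ∧ √5 < (2.2360680:ℝ) := by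
  constructor
  · exact Real.lt_sqrt_of_sq_lt (by norm_num)
  · rw [Real.sqrt_lt' (by norm_num)]; norm_num

lemma qC_pos : 0 < qC (√5) := by
  have := sqrt5_bounds.1
  unfold qC; linarith

lemma stepZ (y1 b : ℝ) (hy1 : 0 < y1) (hf : qf (√5) y1 = 0) (hb : 0 < b) (hb6 : b^6 = 4/5) :
    ∫ y in Ioo 0 y1, (√(y * qf (√5) y))⁻¹ =
      1/√5 * ∫ z in Ioo 0 (b^2), (√(z * (1 - 5/4*z^3)))⁻¹ := by
  obtain ⟨h1, h2⟩ := sqrt5_bounds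
  have hr : (√5:ℝ)^2 = 5 := Real.sq_sqrt (by norm_num)
  have hC := qC_pos
  set r : ℝ := √5 with hrdef
  have hr0 : 0 < r := by linarith
  have hy9 : y1 ≤ 1/9 := by
    unfold qf at hf
    have : 0 ≤ 6*qC r*y1^2 + (qC r)^2*y1^3 := by positivity
    linarith
  have hpos : ∀ y ∈ Icc 0 y1, 0 < qd r y ∧ 0 < qP r y ∧ 0 < qM r y := fun y hy =>
    q_pos r y h1 h2 hy.1 (hy.2.trans hy9)
  have hfpos : ∀ y ∈ Ioo 0 y1, 0 < qf r y := by
    intro y hy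
    rw [← hf]
    unfold qf
    have h0 := hy.1
    have a2 : y^2 ≤ y1^2 := by have := hy.2.le; gcongr
    have a3 : y^3 ≤ y1^3 := by have := hy.2.le; gcongr
    have b2 := mul_le_mul_of_nonneg_left a2 (show 0 ≤ 6 * qC r by positivity)
    have b3 := mul_le_mul_of_nonneg_left a3 (show 0 ≤ (qC r)^2 by positivity)
    linarith [hy.2]
  have hid : ∀ y ∈ Icc 0 y1, (qd r y * qM r y / (qP r y)^2)^2 * (y * qf r y) =
      5 * ((y * (qd r y)^2 / qP r y) * (1 - 5/4*(y * (qd r y)^2 / qP r y)^3)) := by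
    intro y hy
    have hP := (hpos y hy).2.1
    have := q_ident r y hr
    have e : (qd r y * qM r y / (qP r y)^2)^2 * (y * qf r y) =
      y * (qd r y)^2 / (qP r y)^4 * ((qM r y)^2 * qf r y) := by field_simp
    rw [e, this]
    field_simp
    try ring
  have key := (cov (f := fun z => (√(z * (1 - 5/4*z^3)))⁻¹)
    (h := fun y => r * (√(y * qf r y))⁻¹) hy1
    (g := fun y => y * (qd r y)^2 / qP r y) (g' := fun y => qd r y * qM r y / (qP r y)^2)
    (fun y hy => (hasDerivAt_qZ r y (hpos y hy).2.1.ne').continuousAt.continuousWithinAt)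
    (fun y hy => hasDerivAt_qZ r y (hpos y (Ioo_subset_Icc_self hy)).2.1.ne')
    (fun y hy => by
      obtain ⟨h1, h2, h3⟩ := hpos y (Ioo_subset_Icc_self hy)
      positivity) ?_).1
  · have e1 : y1 * (qd r y1)^2 / qP r y1 = b^2 := by
      have hh := hid y1 (right_mem_Icc.2 hy1.le)
      obtain ⟨h1, h2, h3⟩ := hpos y1 (right_mem_Icc.2 hy1.le)
      rw [hf] at hh
      have hz : 0 < y1 * (qd r y1)^2 / qP r y1 := by positivity
      set z := y1 * (qd r y1)^2 / qP r y1
      have h3 : z^3 = (b^2)^3 := by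
        have : z * (1 - 5/4*z^3) = 0 := by linarith
        have : 1 - 5/4*z^3 = 0 := by
          rcases mul_eq_zero.1 this with h | h
          · exact absurd h hz.ne'
          · exact h
        rw [← pow_mul, hb6]; linarith
      exact (pow_left_inj₀ hz.le (by positivity) (by norm_num)).1 h3
    rw [e1] at key
    simp only [zero_mul, zero_div] at key
    rw [key, integral_const_mul]
    field_simp
  · intro y hy
    obtain ⟨h1, h2, h3⟩ := hpos y (Ioo_subset_Icc_self hy)
    have hfy := hfpos y hy
    have hy0 := hy.1
    have hh := hid y (Ioo_subset_Icc_self hy)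
    apply sqrt_swap (by positivity) hr0 _ (by positivity) (by rw [hr]; exact hh)
    have : 0 < (qd r y * qM r y / (qP r y)^2)^2 * (y * qf r y) := by positivity
    linarith

lemma stepT (b : ℝ) (hb : 0 < b) (hb6 : b^6 = 4/5) :
    ∫ z in Ioo 0 (b^2), (√(z * (1 - 5/4*z^3)))⁻¹ =
      b/3 * ∫ t in Ioo (0:ℝ) 1, t ^ (-5/6:ℝ) * (1 - t) ^ (-1/2:ℝ) := by
  have key := (cov (f := fun t : ℝ => t ^ (-5/6:ℝ) * (1 - t) ^ (-1/2:ℝ))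
    (h := fun z => 3/b * (√(z * (1 - 5/4*z^3)))⁻¹) (a := 0) (b := b^2) (by positivity)
    (g := fun z => 5/4*z^3) (g' := fun z => 5/4*(3*z^2)) (by fun_prop)
    (fun z _ => by simpa using (hasDerivAt_pow 3 z).const_mul (5/4))
    (fun z hz => by have := hz.1; positivity) ?_).1
  · have e1 : 5/4*(b^2)^3 = 1 := by rw [← pow_mul, hb6]; norm_num
    simp only [e1] at key
    norm_num only at key
    norm_num only
    rw [key, integral_const_mul, ← mul_assoc, show b/3*(3/b) = 1 by field_simp, one_mul]
  · intro z hz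
    have hz0 := hz.1
    have h1 : 0 < 1 - 5/4*z^3 := by
      have : z^3 < (b^2)^3 := by have := hz.2; gcongr
      rw [← pow_mul, hb6] at this
      linarith
    have e1 : (5/4*z^3)^(-5/6:ℝ) = b^5 * (√z)⁻¹ / z^2 := by
      have : 5/4*z^3 = ((√z)/b)^6 := by
        rw [div_pow, hb6, show (√z)^6 = ((√z)^2)^3 by ring, Real.sq_sqrt hz0.le]; ring
      rw [this, ← Real.rpow_natCast, ← Real.rpow_mul (by positivity),
        show (((6:ℕ):ℝ) * (-5/6)) = -((5:ℕ):ℝ) by norm_num, Real.rpow_neg (by positivity),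
        Real.rpow_natCast]
      have hs : 0 < √z := Real.sqrt_pos.2 hz0
      have : z^2 = (√z)^4 := by rw [show (√z)^4 = ((√z)^2)^2 by ring, Real.sq_sqrt hz0.le]
      rw [this]
      field_simp
    have e2 : (1 - 5/4*z^3)^(-1/2:ℝ) = (√(1 - 5/4*z^3))⁻¹ := by
      rw [Real.sqrt_eq_rpow, ← Real.rpow_neg h1.le]; norm_num
    rw [e1, e2, Real.sqrt_mul hz0.le]
    have hs : 0 < √z := Real.sqrt_pos.2 hz0
    have hs1 : 0 < √(1 - 5/4*z^3) := Real.sqrt_pos.2 h1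
    generalize √(1 - 5/4*z^3) = s at *
    field_simp
    linear_combination 5 * hb6


lemma cov_anti {a b : ℝ} (hab : a < b) {g g' : ℝ → ℝ} (hc : ContinuousOn g (Icc a b))
    (hd : ∀ x ∈ Ioo a b, HasDerivAt g (g' x) x) (hp : ∀ x ∈ Ioo a b, g' x < 0)
    {f h : ℝ → ℝ} (hf : ∀ x ∈ Ioo a b, -g' x * f (g x) = h x) :
    (∫ x in Ioo (g b) (g a), f x = ∫ x in Ioo a b, h x) ∧
    (IntegrableOn f (Ioo (g b) (g a)) ↔ IntegrableOn h (Ioo a b)) := by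
  have hm : StrictAntiOn g (Icc a b) := by
    apply strictAntiOn_of_deriv_neg (convex_Icc a b) hc
    intro x hx
    rw [interior_Icc] at hx
    rw [(hd x hx).deriv]; exact hp x hx
  have hi : g '' Ioo a b = Ioo (g b) (g a) := by
    refine Subset.antisymm ?_ (intermediate_value_Ioo' hab.le hc)
    rintro _ ⟨x, hx, rfl⟩
    exact ⟨hm (Ioo_subset_Icc_self hx) (right_mem_Icc.2 hab.le) hx.2,
      hm (left_mem_Icc.2 hab.le) (Ioo_subset_Icc_self hx) hx.1⟩
  have hinj : InjOn g (Ioo a b) := (hm.mono Ioo_subset_Icc_self).injOn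
  have hd' : ∀ x ∈ Ioo a b, HasDerivWithinAt g (g' x) (Ioo a b) x :=
    fun x hx => (hd x hx).hasDerivWithinAt
  have e : EqOn (fun x => |g' x| • f (g x)) h (Ioo a b) := by
    intro x hx
    simp only [smul_eq_mul, abs_of_neg (hp x hx)]
    exact hf x hx
  constructor
  · rw [← hi, integral_image_eq_integral_abs_deriv_smul measurableSet_Ioo hd' hinj]
    exact setIntegral_congr_fun measurableSet_Ioo e
  · rw [← hi, integrableOn_image_iff_integrableOn_abs_deriv_smul measurableSet_Ioo hd' hinj]
    exact integrableOn_congr_fun e measurableSet_Ioo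

noncomputable def qB (m : ℝ) : ℝ := 9*√5/10*m^3 - m^6 - 1

lemma qB_eq (b m : ℝ) (hb : 0 < b) (hb3 : b^3 = 2*√5/5) :
    qB m = ((1/b)^3 - m^3) * (m^3 - b^3) := by
  have hr : (√5:ℝ)^2 = 5 := Real.sq_sqrt (by norm_num)
  have hr0 : 0 < √(5:ℝ) := by positivity
  have : (1/b)^3 = √5/2 := by
    rw [div_pow, hb3]; field_simp; rw [hr]
  rw [this, hb3, qB]
  linear_combination (1/5) * hr

lemma qB_pos (b m : ℝ) (hb : 0 < b) (hb3 : b^3 = 2*√5/5) (hm : m ∈ Ioo b (1/b)) : 0 < qB m := by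
  rw [qB_eq b m hb hb3]
  have h1 : b^3 < m^3 := by have := hm.1; gcongr
  have h2 : m^3 < (1/b)^3 := by
    have := hm.2
    have h0 : 0 < m := hb.trans hm.1
    gcongr
  exact mul_pos (by linarith) (by linarith)

lemma qf_y (m : ℝ) (hm : m ≠ 0) :
    qf (√5) ((m-1)^2/(m*qC (√5))) = qB m / (qC (√5) * m^3) := by
  have hC := qC_pos.ne'
  have : 9*√5/10 = qC (√5) + 2 := by unfold qC; ring
  unfold qf qB
  rw [this]
  generalize qC (√5) = C at *
  field_simp
  ring

lemma stepY (b : ℝ) (hb : 0 < b) (hb1 : b < 1) (hb3 : b^3 = 2*√5/5) :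
    ∫ m in Ioo 1 (1/b), (m+1) * (√(qB m))⁻¹ =
      ∫ y in Ioo 0 ((1/b-1)^2/((1/b)*qC (√5))), (√(y * qf (√5) y))⁻¹ := by
  have hC := qC_pos
  have h1b : 1 < 1/b := by rw [lt_div_iff₀ hb]; linarith
  have hd : ∀ m : ℝ, 0 < m → HasDerivAt (fun m => (m-1)^2/(m*qC (√5)))
      ((m^2-1)/(m^2*qC (√5))) m := by
    intro m hm
    have h := (((hasDerivAt_id m).sub_const 1).pow 2).div
      ((hasDerivAt_id m).mul_const (qC (√5))) (by simp only [id]; positivity)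
    refine (h.congr_deriv ?_).congr_of_eventuallyEq ?_
    · simp only [id]
      field_simp
      simp
      ring
    · exact Filter.Eventually.of_forall fun x => by simp
  have key := (cov (f := fun y => (√(y * qf (√5) y))⁻¹)
    (h := fun m => (m+1) * (√(qB m))⁻¹) h1b
    (g := fun m => (m-1)^2/(m*qC (√5))) (g' := fun m => (m^2-1)/(m^2*qC (√5)))
    (fun m hm => (hd m (by linarith [hm.1])).continuousAt.continuousWithinAt)
    (fun m hm => hd m (by linarith [hm.1]))
    (fun m hm => by
      have h0 : 0 < m := by linarith [hm.1]
      have h1 : 0 < m^2-1 := by nlinarith [hm.1]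
      positivity) ?_).1
  · simp only [sub_self] at key
    rw [← key]
    norm_num
  · intro m hm
    have h0 : 0 < m := by linarith [hm.1]
    have h1 : 0 < m - 1 := by linarith [hm.1]
    have h2 : 0 < m^2-1 := by nlinarith [hm.1]
    have hB := qB_pos b m hb hb3 ⟨by linarith [hm.1], hm.2⟩
    rw [qf_y m h0.ne']
    apply sqrt_swap (by positivity) (by positivity) (by positivity) hB
    field_simp
    ring

lemma stepM (b : ℝ) (hb : 0 < b) (hb1 : b < 1) (hb3 : b^3 = 2*√5/5)
    (hint : IntegrableOn (fun m => m * (√(qB m))⁻¹) (Ioo b (1/b))) :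
    ∫ m in Ioo b (1/b), m * (√(qB m))⁻¹ = ∫ m in Ioo 1 (1/b), (m+1) * (√(qB m))⁻¹ := by
  have h1b : 1 < 1/b := by rw [lt_div_iff₀ hb]; linarith
  have key := cov_anti (f := fun m => m * (√(qB m))⁻¹)
    (h := fun m => (√(qB m))⁻¹) h1b
    (g := fun m => m⁻¹) (g' := fun m => -(m^2)⁻¹)
    (fun m hm => (hasDerivAt_inv (by linarith [hm.1] : m ≠ 0)).continuousAt.continuousWithinAt)
    (fun m hm => hasDerivAt_inv (by linarith [hm.1]))
    (fun m hm => by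
      have h0 : 0 < m := by linarith [hm.1]
      have : 0 < (m^2)⁻¹ := by positivity
      linarith) ?_
  · simp only [inv_one, one_div, inv_inv] at key hint ⊢
    rw [one_div] at h1b
    obtain ⟨k1, k2⟩ := key
    have i1 : IntegrableOn (fun m => m * (√(qB m))⁻¹) (Ioo b 1) :=
      hint.mono_set (Ioo_subset_Ioo_right h1b.le)
    have i2 : IntegrableOn (fun m => m * (√(qB m))⁻¹) (Ioo 1 b⁻¹) :=
      hint.mono_set (Ioo_subset_Ioo_left hb1.le)
    have i3 := k2.1 i1
    have e : ∀ m : ℝ, (m+1) * (√(qB m))⁻¹ = m * (√(qB m))⁻¹ + (√(qB m))⁻¹ := fun m => by ring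
    simp_rw [e]
    rw [integral_add i2 i3, ← k1]
    simp only [← integral_Ioc_eq_integral_Ioo]
    rw [← intervalIntegral.integral_of_le hb1.le, ← intervalIntegral.integral_of_le h1b.le,
      ← intervalIntegral.integral_of_le (hb1.le.trans h1b.le), add_comm,
      intervalIntegral.integral_add_adjacent_intervals]
    · exact (intervalIntegrable_iff_integrableOn_Ioo_of_le hb1.le).2 i1
    · exact (intervalIntegrable_iff_integrableOn_Ioo_of_le h1b.le).2 i2
  · intro m hm
    have h0 : 0 < m := by linarith [hm.1]
    have hB := qB_pos b m hb hb3 ⟨by linarith [hm.1], hm.2⟩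
    have hB2 : qB m⁻¹ = qB m / m^6 := by unfold qB; field_simp; ring
    have := sqrt_swap (G := (m^2)⁻¹ * m⁻¹) (n := 1) (A := qB m / m^6) (B := qB m)
      (by positivity) (by norm_num) (by positivity) hB (by field_simp)
    rw [hB2]
    rw [one_mul] at this
    rw [← this]; ring

lemma stepTh (b : ℝ) (hb : 0 < b) (hb6 : b^6 = 4/5) (hb3 : b^3 = 2*√5/5) :
    IntegrableOn (fun m => m * (√(qB m))⁻¹) (Ioo b (1/b)) ∧
    ∫ θ in Ioo (0:ℝ) (Real.pi/2), ((1 - Real.cos θ ^ 2 / 5) ^ (1/3:ℝ))⁻¹ =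
      3/(2*b) * ∫ m in Ioo b (1/b), m * (√(qB m))⁻¹ := by
  have hpos : ∀ θ, 0 < 1 - Real.cos θ ^ 2 / 5 := fun θ => by
    have := Real.cos_sq_le_one θ; linarith
  have hd : ∀ θ, HasDerivAt (fun θ => (1 - Real.cos θ ^ 2 / 5) ^ (1/3:ℝ) / b)
      (2/15 * Real.cos θ * Real.sin θ / (((1 - Real.cos θ ^ 2 / 5) ^ (1/3:ℝ))^2 * b)) θ := by
    intro θ
    have h := (((((Real.hasDerivAt_cos θ).pow 2).div_const 5).const_sub 1).rpow_const
      (p := 1/3) (Or.inl (hpos θ).ne')).div_const b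
    refine (h.congr_deriv ?_).congr_of_eventuallyEq ?_
    · have e : (1 - Real.cos θ ^ 2 / 5) ^ (1/3-1:ℝ) =
          (((1 - Real.cos θ ^ 2 / 5) ^ (1/3:ℝ))^2)⁻¹ := by
        have hw := hpos θ
        generalize 1 - Real.cos θ ^ 2 / 5 = w at hw
        rw [← Real.rpow_natCast, ← Real.rpow_mul hw.le, ← Real.rpow_neg hw.le]
        norm_num
      simp only [Pi.pow_apply]
      rw [e]
      have := Real.rpow_pos_of_pos (hpos θ) (1/3)
      field_simp
      simp
      try ring
    · exact Filter.Eventually.of_forall fun x => by simp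
  have hU3 : ∀ θ, ((1 - Real.cos θ ^ 2 / 5) ^ (1/3:ℝ))^3 = 1 - Real.cos θ ^ 2 / 5 := fun θ => by
    rw [← Real.rpow_natCast, ← Real.rpow_mul (hpos θ).le]; norm_num
  have hpi : (0:ℝ) < Real.pi/2 := by positivity
  have hcs : ∀ θ ∈ Ioo 0 (Real.pi/2), 0 < Real.cos θ ∧ 0 < Real.sin θ := fun θ hθ =>
    ⟨Real.cos_pos_of_mem_Ioo ⟨by linarith [hθ.1], hθ.2⟩,
      Real.sin_pos_of_pos_of_lt_pi hθ.1 (by linarith [hθ.2])⟩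
  have key := cov (f := fun m => m * (√(qB m))⁻¹)
    (h := fun θ => 2*b/3 * ((1 - Real.cos θ ^ 2 / 5) ^ (1/3:ℝ))⁻¹) hpi
    (g := fun θ => (1 - Real.cos θ ^ 2 / 5) ^ (1/3:ℝ) / b)
    (g' := fun θ => 2/15 * Real.cos θ * Real.sin θ / (((1 - Real.cos θ ^ 2 / 5) ^ (1/3:ℝ))^2 * b))
    (fun θ _ => (hd θ).continuousAt.continuousWithinAt) (fun θ _ => hd θ)
    (fun θ hθ => by
      obtain ⟨h1, h2⟩ := hcs θ hθ
      have := Real.rpow_pos_of_pos (hpos θ) (1/3)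
      positivity) ?_
  · have e0 : (1 - Real.cos 0 ^ 2 / 5) ^ (1/3:ℝ) / b = b := by
      rw [div_eq_iff hb.ne', Real.cos_zero, show (1 - 1^2/5:ℝ) = (b*b)^3 by
        rw [show (b*b)^3 = b^6 by ring, hb6]; norm_num, ← Real.rpow_natCast,
        ← Real.rpow_mul (by positivity)]
      norm_num
    have e1 : (1 - Real.cos (Real.pi/2) ^ 2 / 5) ^ (1/3:ℝ) / b = 1/b := by
      rw [Real.cos_pi_div_two]; norm_num
    simp only [e0, e1] at key
    obtain ⟨k1, k2⟩ := key
    constructor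
    · rw [k2]
      apply (Continuous.integrableOn_Icc _).mono_set Ioo_subset_Icc_self
      refine continuous_const.mul (Continuous.inv₀ ?_ ?_)
      · exact Continuous.rpow_const (by fun_prop) fun θ => Or.inl (hpos θ).ne'
      · exact fun θ => (Real.rpow_pos_of_pos (hpos θ) _).ne'
    · rw [k1, integral_const_mul, ← mul_assoc, show 3/(2*b)*(2*b/3) = 1 by field_simp, one_mul]
  · intro θ hθ
    obtain ⟨h1, h2⟩ := hcs θ hθ
    have hU := Real.rpow_pos_of_pos (hpos θ) (1/3)
    have h3 := hU3 θ
    set U := (1 - Real.cos θ ^ 2 / 5) ^ (1/3:ℝ)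
    have hB : qB (U/b) = (Real.cos θ * Real.sin θ / (5*b^3))^2 := by
      rw [qB_eq b _ hb hb3, div_pow, div_pow U, h3]
      have : (Real.cos θ * Real.sin θ / (5*b^3))^2 =
        Real.cos θ^2 * (1 - Real.cos θ^2) / (25 * b^6) := by
        rw [← Real.sin_sq]; field_simp; norm_num
      rw [this]
      field_simp
      have : b^6 = b^3*b^3 := by ring
      linear_combination (-125 * Real.cos θ^2) * hb6
    rw [hB, Real.sqrt_sq (by positivity)]
    field_simp
    try norm_num

lemma final_eq : twoFone (1/3) (1/2) 1 (1/5) = (3/20) * (2:ℝ) ^ ((2:ℝ)/3) * Real.sqrt 5 *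
    Real.Gamma (1/3) ^ 3 / Real.pi ^ 2 := by
  have hr : (√5:ℝ)^2 = 5 := Real.sq_sqrt (by norm_num)
  have hr0 : 0 < √(5:ℝ) := by positivity
  obtain ⟨b, hb, hb6⟩ : ∃ b : ℝ, 0 < b ∧ b^6 = 4/5 := by
    refine ⟨(4/5:ℝ)^(1/6:ℝ), by positivity, ?_⟩
    rw [← Real.rpow_natCast, ← Real.rpow_mul (by norm_num)]; norm_num
  have hb1 : b < 1 := by
    by_contra h
    have := one_le_pow₀ (not_lt.1 h) (n := 6)
    linarith
  have hb3 : b^3 = 2*√5/5 := by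
    have : (b^3)^2 = (2*√5/5)^2 := by rw [← pow_mul, hb6, div_pow, mul_pow, hr]; norm_num
    exact (pow_left_inj₀ (by positivity) (by positivity) (by norm_num)).1 this
  obtain ⟨hint, hTh⟩ := stepTh b hb hb6 hb3
  have hC := qC_pos
  have h1b : 0 < 1/b - 1 := by rw [sub_pos, lt_div_iff₀ hb]; linarith
  have hy : 0 < (1/b-1)^2/((1/b)*qC (√5)) := by positivity
  have hf : qf (√5) ((1/b-1)^2/((1/b)*qC (√5))) = 0 := by
    rw [qf_y _ (by positivity), qB_eq b _ hb hb3]; simp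
  rw [series_int, hTh, stepM b hb hb1 hb3 hint, stepY b hb hb1 hb3, stepZ _ b hy hf hb hb6,
    stepT b hb hb6, beta_int]
  have hp := Real.pi_pos
  field_simp
  rw [hr]
  try norm_num

theorem stmt14 : twoFone (1/3) (1/2) (1) (1/5) = (3/20) * (2:ℝ) ^ ((2:ℝ)/3) * Real.sqrt 5 * Real.Gamma (1/3) ^ 3 / Real.pi ^ 2 := final_eq
end

section
/- For all complex a with Re(a) ≥ 0, Appell's hypergeometric series satisfies F₁(2a; a+1/2, 4a−1; 2a+1/2; 1/81, 1/6) = (3^{8a} / (2^{2a} 5^{5a})) · √π · Γ(2a+1/2) / Γ(a+1/2)². -/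
open scoped Nat

/-- Pochhammer symbol (rising factorial) on the complex numbers. -/
noncomputable def cpoch (a : ℂ) (n : ℕ) : ℂ := ∏ i ∈ Finset.range n, (a + i)

/-- Appell's hypergeometric series F₁(α; β₁, β₂; γ; x, y) as a complex double series. -/
noncomputable def appellF1 (α β₁ β₂ γ x y : ℂ) : ℂ :=
  ∑' p : ℕ × ℕ,
    cpoch α (p.1 + p.2) * cpoch β₁ p.1 * cpoch β₂ p.2 /
      (cpoch γ (p.1 + p.2) * (p.1 ! : ℂ) * (p.2 ! : ℂ)) * x ^ p.1 * y ^ p.2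

lemma cpoch_succ' (a : ℂ) (n : ℕ) : cpoch a (n+1) = cpoch a n * (a + n) := by
  simp [cpoch, Finset.prod_range_succ]

lemma choose_cpoch (b : ℂ) (n : ℕ) : Ring.choose (b + n - 1) n = cpoch b n / (n ! : ℂ) := by
  have h := Ring.factorial_nsmul_multichoose_eq_ascPochhammer b n
  rw [Ring.multichoose_eq, Polynomial.ascPochhammer_smeval_eq_eval] at h
  have h2 : (ascPochhammer ℂ n).eval b = cpoch b n := by
    clear h
    induction n with
    | zero => simp [cpoch]
    | succ k ih => rw [ascPochhammer_succ_eval, ih, cpoch_succ']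
  rw [h2, nsmul_eq_mul] at h
  have h3 : (n ! : ℂ) ≠ 0 := by exact_mod_cast Nat.factorial_ne_zero n
  rw [← h]; field_simp

lemma binom_hasSum_s15 (b z : ℂ) (hz : ‖z‖ < 1) :
    HasSum (fun n : ℕ => cpoch b n / (n ! : ℂ) * z ^ n) (1 / (1 - z) ^ b) := by
  have h := (Complex.one_div_one_sub_cpow_hasFPowerSeriesOnBall_zero b).hasSum (y := z)
    (by rw [Metric.mem_eball, edist_zero_right, ← ofReal_norm]; exact ENNReal.ofReal_lt_one.2 hz)
  simp only [zero_add, FormalMultilinearSeries.ofScalars_apply_eq, choose_cpoch] at h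
  simpa [smul_eq_mul] using h

lemma norm_cpoch_le (b : ℂ) (B : ℝ) (h : ‖b‖ ≤ B) (n : ℕ) : ‖cpoch b n‖ ≤ ‖cpoch (B : ℂ) n‖ := by
  unfold cpoch
  rw [norm_prod, norm_prod]
  refine Finset.prod_le_prod (fun _ _ => norm_nonneg _) fun i _ => ?_
  have hB : 0 ≤ B := (norm_nonneg _).trans h
  have : ‖(B : ℂ) + i‖ = B + i := by
    rw [show (B : ℂ) + i = ((B + i : ℝ) : ℂ) by push_cast; rfl, Complex.norm_real,
      Real.norm_of_nonneg (by positivity)]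
  rw [this]
  refine (norm_add_le _ _).trans ?_
  simpa using h

lemma norm_ratio_le (α : ℂ) (h : 0 ≤ α.re) (k : ℕ) : ‖cpoch α k / cpoch (α + 1/2) k‖ ≤ 1 := by
  unfold cpoch
  rw [← Finset.prod_div_distrib, norm_prod]
  refine Finset.prod_le_one (fun _ _ => norm_nonneg _) fun i _ => ?_
  rw [norm_div]
  refine div_le_one_of_le₀ ?_ (norm_nonneg _)
  rw [Complex.norm_def, Complex.norm_def]
  apply Real.sqrt_le_sqrt
  simp only [Complex.normSq_apply, Complex.add_re, Complex.add_im, Complex.natCast_re,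
    Complex.natCast_im]
  norm_num
  have : (0:ℝ) ≤ i := by positivity
  nlinarith

/-- the summand with ratio separated -/
lemma term_eq (α β₁ β₂ γ x y : ℂ) (p : ℕ × ℕ) :
    cpoch α (p.1 + p.2) * cpoch β₁ p.1 * cpoch β₂ p.2 /
      (cpoch γ (p.1 + p.2) * (p.1 ! : ℂ) * (p.2 ! : ℂ)) * x ^ p.1 * y ^ p.2 =
    (cpoch α (p.1 + p.2) / cpoch γ (p.1 + p.2)) *
      ((cpoch β₁ p.1 / (p.1 ! : ℂ) * x ^ p.1) * (cpoch β₂ p.2 / (p.2 ! : ℂ) * y ^ p.2)) := by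
  simp only [div_eq_mul_inv, mul_inv]; ring

lemma summable_dom (B₁ B₂ x y : ℂ) (hx : ‖x‖ < 1) (hy : ‖y‖ < 1) :
    Summable fun p : ℕ × ℕ =>
      ‖(cpoch B₁ p.1 / (p.1 ! : ℂ) * x ^ p.1) * (cpoch B₂ p.2 / (p.2 ! : ℂ) * y ^ p.2)‖ :=
  Summable.mul_norm (f := fun m : ℕ => cpoch B₁ m / (m ! : ℂ) * x ^ m)
    (g := fun m : ℕ => cpoch B₂ m / (m ! : ℂ) * y ^ m)
    (binom_hasSum_s15 B₁ x hx).summable.norm (binom_hasSum_s15 B₂ y hy).summable.norm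

lemma cpoch_ne_zero (a : ℂ) (h : 0 < a.re) (n : ℕ) : cpoch a n ≠ 0 := by
  unfold cpoch
  refine Finset.prod_ne_zero_iff.2 fun i _ h0 => ?_
  have := congrArg Complex.re h0
  simp at this
  have h2 : (0:ℝ) ≤ i := by positivity
  linarith

lemma continuous_cpoch (n : ℕ) : Continuous fun a => cpoch a n := by
  unfold cpoch; fun_prop

lemma cont_lhs (R : ℝ) : ContinuousOn
    (fun a : ℂ => appellF1 (2*a) (a + 1/2) (4*a - 1) (2*a + 1/2) (1/81) (1/6))
    {a | 0 ≤ a.re ∧ ‖a‖ ≤ R} := by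
  unfold appellF1
  simp only [term_eq]
  refine continuousOn_tsum ?_ (summable_dom ((R + 1/2 : ℝ) : ℂ) ((4 * R + 1 : ℝ) : ℂ) (1/81) (1/6)
    (by norm_num) (by norm_num)) ?_
  · intro p
    have := continuous_cpoch
    refine ContinuousOn.mul (ContinuousOn.div ?_ ?_ ?_) ?_
    · exact ((continuous_cpoch _).comp (by fun_prop : Continuous fun a : ℂ => 2 * a)).continuousOn
    · exact ((continuous_cpoch _).comp (by fun_prop : Continuous fun a : ℂ => 2 * a + 1/2)).continuousOn
    · intro a ha
      apply cpoch_ne_zero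
      have := ha.1
      simp; norm_num; linarith
    · have h1 := ((continuous_cpoch p.1).comp (by fun_prop : Continuous fun a : ℂ => a + 1/2))
      have h2 := ((continuous_cpoch p.2).comp (by fun_prop : Continuous fun a : ℂ => 4 * a - 1))
      simp only [Function.comp_def] at h1 h2
      fun_prop
  · intro p a ha
    rw [norm_mul]
    refine (mul_le_of_le_one_left (norm_nonneg _) (norm_ratio_le _ (by simpa using ha.1) _)).trans ?_
    simp only [norm_mul, norm_div]
    have h1 := norm_cpoch_le (a + 1/2) (R + 1/2) (by
      refine (norm_add_le _ _).trans ?_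
      have := ha.2
      norm_num; linarith) p.1
    have h2 := norm_cpoch_le (4 * a - 1) (4 * R + 1) (by
      refine (norm_sub_le _ _).trans ?_
      have := ha.2
      norm_num; linarith) p.2
    gcongr

lemma beta_ratio (α : ℂ) (h : 0 < α.re) (k : ℕ) :
    Complex.betaIntegral (α + k) (1/2) =
      cpoch α k / cpoch (α + 1/2) k * Complex.betaIntegral α (1/2) := by
  have key : ∀ s : ℂ, 0 < s.re → Complex.Gamma (s + k) = cpoch s k * Complex.Gamma s := by
    intro s hs
    induction k with
    | zero => simp [cpoch]
    | succ k ih =>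
      have : s + k ≠ 0 := by
        intro h0
        have := congrArg Complex.re h0
        simp at this
        have h2 : (0:ℝ) ≤ k := by positivity
        linarith
      rw [cpoch_succ', Nat.cast_succ, ← add_assoc, Complex.Gamma_add_one _ this, ih]; ring
  have hk : (0:ℝ) ≤ k := by positivity
  have h2 : 0 < (α + 1/2).re := by simp; norm_num; linarith
  rw [Complex.betaIntegral_eq_Gamma_mul_div _ _ (by simp; linarith) (by norm_num),
    Complex.betaIntegral_eq_Gamma_mul_div _ _ h (by norm_num), key _ h,
    show α + k + 1/2 = (α + 1/2) + k by ring, key _ h2]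
  have := cpoch_ne_zero _ h2 k
  have := Complex.Gamma_ne_zero_of_re_pos h2
  field_simp

open MeasureTheory Set in
lemma euler_int (α β₁ β₂ : ℂ) (x y : ℝ) (h : 0 < α.re) (hx : |x| < 1) (hy : |y| < 1) :
    Complex.betaIntegral α (1/2) * appellF1 α β₁ β₂ (α + 1/2) x y =
      ∫ t in Ioo (0:ℝ) 1, (t:ℂ) ^ (α - 1) * (1 - (t:ℂ)) ^ ((1/2:ℂ) - 1) *
        (1 / (1 - (x * t : ℂ)) ^ β₁ * (1 / (1 - (y * t : ℂ)) ^ β₂)) := by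
  set w : ℝ → ℂ := fun t => (t:ℂ) ^ (α - 1) * (1 - (t:ℂ)) ^ ((1/2:ℂ) - 1) with hw
  have hint : IntegrableOn w (Ioo 0 1) := by
    have := Complex.betaIntegral_convergent h (v := 1/2) (by norm_num)
    rwa [intervalIntegrable_iff_integrableOn_Ioo_of_le zero_le_one] at this
  set C : ℕ × ℕ → ℂ := fun p =>
    (cpoch β₁ p.1 / (p.1 ! : ℂ) * (x:ℂ) ^ p.1) * (cpoch β₂ p.2 / (p.2 ! : ℂ) * (y:ℂ) ^ p.2) with hC
  have hCs : Summable fun p => ‖C p‖ :=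
    summable_dom β₁ β₂ x y (by simpa using hx) (by simpa using hy)
  have hbound : ∀ p : ℕ × ℕ, ∀ t ∈ Ioo (0:ℝ) 1,
      ‖C p * (t:ℂ) ^ (p.1 + p.2) * w t‖ ≤ ‖C p‖ * ‖w t‖ := by
    intro p t ht
    rw [norm_mul, norm_mul, norm_pow, Complex.norm_real, Real.norm_of_nonneg ht.1.le]
    gcongr
    exact mul_le_of_le_one_right (norm_nonneg _) (pow_le_one₀ ht.1.le ht.2.le)
  have hintp : ∀ p : ℕ × ℕ, IntegrableOn (fun t : ℝ => C p * (t:ℂ) ^ (p.1 + p.2) * w t) (Ioo 0 1) := by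
    intro p
    refine Integrable.mono' (hint.norm.const_mul ‖C p‖) ?_ ?_
    · exact (Continuous.aestronglyMeasurable (by fun_prop)).mul hint.aestronglyMeasurable
    · exact (ae_restrict_iff' measurableSet_Ioo).2 (.of_forall (hbound p))
  have hsw := hasSum_integral_of_summable_integral_norm (μ := volume.restrict (Ioo (0:ℝ) 1))
    (F := fun (p : ℕ × ℕ) (t : ℝ) => C p * (t:ℂ) ^ (p.1 + p.2) * w t) hintp (by
      refine Summable.of_nonneg_of_le (fun p => integral_nonneg fun _ => norm_nonneg _) (fun p => ?_)
        (hCs.mul_right (∫ t in Ioo (0:ℝ) 1, ‖w t‖))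
      rw [← integral_const_mul]
      exact setIntegral_mono_on (hintp p).norm (hint.norm.const_mul _) measurableSet_Ioo (hbound p))
  have e1 : ∀ p : ℕ × ℕ, ∫ t in Ioo (0:ℝ) 1, C p * (t:ℂ) ^ (p.1 + p.2) * w t =
      Complex.betaIntegral α (1/2) * (cpoch α (p.1 + p.2) / cpoch (α + 1/2) (p.1 + p.2) * C p) := by
    intro p
    have : ∫ t in Ioo (0:ℝ) 1, C p * (t:ℂ) ^ (p.1 + p.2) * w t =
        C p * Complex.betaIntegral (α + (p.1 + p.2 : ℕ)) (1/2) := by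
      rw [Complex.betaIntegral, intervalIntegral.integral_of_le zero_le_one,
        integral_Ioc_eq_integral_Ioo, ← integral_const_mul]
      refine setIntegral_congr_fun measurableSet_Ioo fun t ht => ?_
      have ht0 : (t:ℂ) ≠ 0 := by exact_mod_cast ht.1.ne'
      simp only [hw]
      rw [show α + ((p.1 + p.2 : ℕ) : ℂ) - 1 = (α - 1) + ((p.1 + p.2 : ℕ) : ℂ) by ring,
        Complex.cpow_add _ _ ht0, Complex.cpow_natCast]
      ring
    rw [this, beta_ratio α h]; ring
  rw [appellF1, ← tsum_mul_left]
  simp only [term_eq]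
  rw [← tsum_congr e1, hsw.tsum_eq]
  refine setIntegral_congr_fun measurableSet_Ioo fun t ht => ?_
  have hsm : ∀ z : ℝ, |z| < 1 → ‖(z * t : ℂ)‖ < 1 := by
    intro z hz
    rw [norm_mul, Complex.norm_real, Complex.norm_real, Real.norm_of_nonneg ht.1.le]
    exact (mul_le_of_le_one_right (norm_nonneg _) ht.2.le).trans_lt hz
  have b1 := binom_hasSum_s15 β₁ _ (hsm x hx)
  have b2 := binom_hasSum_s15 β₂ _ (hsm y hy)
  rw [tsum_mul_right, ← b1.tsum_eq, ← b2.tsum_eq,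
    tsum_mul_tsum_of_summable_norm b1.summable.norm b2.summable.norm, mul_comm]
  congr 1
  refine tsum_congr fun p => ?_
  simp only [hC, mul_pow, pow_add]; ring

noncomputable def uu (t : ℝ) : ℝ := 3125/6561 * t^2 / ((1 - t/81) * (1 - t/6)^4)

noncomputable def qq (t : ℝ) : ℝ := 1 + 13/81 * t - t^2/324

noncomputable def du (t : ℝ) : ℝ := 2 * uu t * qq t / (t * (1 - t/81) * (1 - t/6))

lemma uu_deriv (t : ℝ) (h0 : 0 < t) (h1 : t < 1) : HasDerivAt uu (du t) t := by
  have p1 : 1 - t/81 ≠ 0 := by linarith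
  have p2 : 1 - t/6 ≠ 0 := by linarith
  have p3 : t ≠ 0 := h0.ne'
  have hn : HasDerivAt (fun t : ℝ => 3125/6561 * t^2) (3125/6561 * (2 * t)) t := by
    simpa using (hasDerivAt_pow 2 t).const_mul (3125/6561 : ℝ)
  have hd1 : HasDerivAt (fun t : ℝ => 1 - t/81) (-(1/81)) t := by
    simpa using ((hasDerivAt_id t).div_const 81).const_sub 1
  have hd2 : HasDerivAt (fun t : ℝ => 1 - t/6) (-(1/6)) t := by
    simpa using ((hasDerivAt_id t).div_const 6).const_sub 1
  have := hn.div (hd1.mul (hd2.pow 4)) (mul_ne_zero p1 (pow_ne_zero 4 p2))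
  refine HasDerivAt.congr_deriv this ?_
  have q1 : 81 - t ≠ 0 := by linarith
  have q2 : 6 - t ≠ 0 := by linarith
  simp only [du, uu, qq, Pi.mul_apply, Pi.pow_apply]
  field_simp
  push_cast
  ring

lemma one_sub_uu (t : ℝ) (h0 : 0 < t) (h1 : t < 1) :
    1 - uu t = (1 - t) * qq t ^ 2 / ((1 - t/81) * (1 - t/6)^4) := by
  have p1 : 1 - t/81 ≠ 0 := by linarith
  have p2 : 1 - t/6 ≠ 0 := by linarith
  have p3 : (1 - t/81) * (1 - t/6)^4 ≠ 0 := mul_ne_zero p1 (pow_ne_zero 4 p2)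
  rw [uu, qq, eq_div_iff p3, sub_mul, div_mul_cancel₀ _ p3]
  ring

lemma uu_mono : StrictMonoOn uu (Set.Icc 0 1) := by
  intro s hs t ht hst
  have := hs.1; have := hs.2; have := ht.1; have := ht.2
  have a1 : 0 < 1 - t/81 := by linarith
  have a2 : 0 < 1 - t/6 := by linarith
  unfold uu
  apply div_lt_div₀
  · nlinarith
  · gcongr
    linarith
  · positivity
  · positivity

lemma uu_cont : ContinuousOn uu (Set.Icc 0 1) := by
  unfold uu
  refine ContinuousOn.div (by fun_prop) (by fun_prop) ?_
  intro t ht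
  have := ht.2
  have a1 : 0 < 1 - t/81 := by linarith
  have a2 : 0 < 1 - t/6 := by linarith
  positivity

lemma uu_image : uu '' Set.Ioo 0 1 = Set.Ioo 0 1 := by
  have e0 : uu 0 = 0 := by norm_num [uu]
  have e1 : uu 1 = 1 := by norm_num [uu]
  apply Set.Subset.antisymm
  · rintro _ ⟨t, ht, rfl⟩
    constructor
    · rw [← e0]; exact uu_mono (by simp) ⟨ht.1.le, ht.2.le⟩ ht.1
    · rw [← e1]; exact uu_mono ⟨ht.1.le, ht.2.le⟩ (by simp) ht.2
  · have := intermediate_value_Ioo zero_le_one uu_cont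
    rwa [e0, e1] at this

lemma cpow_pos' (r : ℝ) (h : 0 < r) (s : ℂ) : (r : ℂ) ^ s = Complex.exp ((Real.log r : ℂ) * s) := by
  rw [Complex.cpow_def_of_ne_zero (by exact_mod_cast h.ne'), Complex.ofReal_log h.le]

lemma pt (a : ℂ) (t : ℝ) (h0 : 0 < t) (h1 : t < 1) :
    |du t| • ((uu t : ℂ) ^ (a - 1) * (1 - (uu t : ℂ)) ^ ((1/2:ℂ) - 1)) =
    2 * ((3125/6561 : ℝ) : ℂ) ^ a * ((t:ℂ) ^ (2*a - 1) * (1 - (t:ℂ)) ^ ((1/2:ℂ) - 1) *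
        (1 / (1 - (((1/81 : ℝ) : ℂ) * t : ℂ)) ^ (a + 1/2) *
          (1 / (1 - (((1/6 : ℝ) : ℂ) * t : ℂ)) ^ (4*a-1)))) := by
  have a0 : 0 < 1 - t := by linarith
  have a1 : 0 < 1 - t/81 := by linarith
  have a2 : 0 < 1 - t/6 := by linarith
  have a3 : 0 < qq t := by unfold qq; nlinarith
  have hu : 0 < uu t := by unfold uu; positivity
  have hd : 0 < du t := by unfold du; positivity
  have hv : 0 < 1 - uu t := by rw [one_sub_uu t h0 h1]; positivity
  have lu : Real.log (uu t) = Real.log (3125/6561) + 2 * Real.log t - Real.log (1 - t/81)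
      - 4 * Real.log (1 - t/6) := by
    unfold uu
    rw [Real.log_div (by positivity) (by positivity), Real.log_mul (by positivity) (by positivity),
      Real.log_mul (by positivity) (by positivity), Real.log_pow, Real.log_pow]
    push_cast; ring
  have lv : Real.log (1 - uu t) = Real.log (1 - t) + 2 * Real.log (qq t) - Real.log (1 - t/81)
      - 4 * Real.log (1 - t/6) := by
    rw [one_sub_uu t h0 h1]
    rw [Real.log_div (by positivity) (by positivity), Real.log_mul (by positivity) (by positivity),
      Real.log_mul (by positivity) (by positivity), Real.log_pow, Real.log_pow]
    push_cast; ring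
  have ld : Real.log (du t) = Real.log 2 + Real.log (uu t) + Real.log (qq t) - Real.log t -
      Real.log (1 - t/81) - Real.log (1 - t/6) := by
    unfold du
    rw [Real.log_div (by positivity) (by positivity), Real.log_mul (by positivity) (by positivity),
      Real.log_mul (by positivity) (by positivity), Real.log_mul (by positivity) (by positivity),
      Real.log_mul (by positivity) (by positivity)]
    ring
  rw [abs_of_pos hd, Complex.real_smul]
  have hdc : (du t : ℂ) = Complex.exp (Real.log (du t) : ℂ) := by
    rw [← Complex.ofReal_exp, Real.exp_log hd]
  have h2c : (2 : ℂ) = Complex.exp (Real.log 2 : ℂ) := by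
    rw [← Complex.ofReal_exp, Real.exp_log two_pos]; norm_num
  have r1 : (1 : ℂ) - (uu t : ℂ) = ((1 - uu t : ℝ) : ℂ) := by push_cast; ring
  have r2 : (1 : ℂ) - (t : ℂ) = ((1 - t : ℝ) : ℂ) := by push_cast; ring
  have r3 : (1 : ℂ) - (((1/81 : ℝ) : ℂ) * t : ℂ) = ((1 - t/81 : ℝ) : ℂ) := by push_cast; ring
  have r4 : (1 : ℂ) - (((1/6 : ℝ) : ℂ) * t : ℂ) = ((1 - t/6 : ℝ) : ℂ) := by push_cast; ring
  rw [r1, r2, r3, r4, cpow_pos' _ hu, cpow_pos' _ hv, cpow_pos' _ a0, cpow_pos' _ a1,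
    cpow_pos' _ a2, cpow_pos' _ h0, cpow_pos' _ (by norm_num : (0:ℝ) < 3125/6561), hdc]
  have h2c' : ∀ z : ℂ, 2 * z = Complex.exp (Real.log 2 : ℂ) * z := fun z => by rw [← h2c]
  rw [mul_assoc (2:ℂ), h2c' (Complex.exp _ * _)]
  simp only [one_div (Complex.exp _), ← Complex.exp_neg, ← Complex.exp_add]
  congr 1
  rw [ld, lv, lu]
  push_cast
  ring

open MeasureTheory Set in
lemma subst_int (a : ℂ) : Complex.betaIntegral a (1/2) =
    2 * ((3125/6561 : ℝ) : ℂ) ^ a * ∫ t in Ioo (0:ℝ) 1,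
      ((t:ℂ) ^ (2*a - 1) * (1 - (t:ℂ)) ^ ((1/2:ℂ) - 1) *
        (1 / (1 - (((1/81 : ℝ) : ℂ) * t : ℂ)) ^ (a + 1/2) *
          (1 / (1 - (((1/6 : ℝ) : ℂ) * t : ℂ)) ^ (4*a-1)))) := by
  rw [Complex.betaIntegral, intervalIntegral.integral_of_le zero_le_one,
        integral_Ioc_eq_integral_Ioo, ← integral_const_mul]
  rw [← uu_image, integral_image_eq_integral_abs_deriv_smul measurableSet_Ioo
    (fun t ht => (uu_deriv t ht.1 ht.2).hasDerivWithinAt)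
    (uu_mono.injOn.mono Ioo_subset_Icc_self), uu_image]
  exact setIntegral_congr_fun measurableSet_Ioo fun t ht => pt a t ht.1 ht.2

lemma c0_pow (a : ℂ) : ((3125/6561 : ℝ) : ℂ) ^ a = (5:ℂ) ^ (5*a) / (3:ℂ) ^ (8*a) := by
  rw [show (5:ℂ) = ((5:ℝ):ℂ) by norm_num, show (3:ℂ) = ((3:ℝ):ℂ) by norm_num,
    cpow_pos' _ (by norm_num), cpow_pos' _ (by norm_num), cpow_pos' _ (by norm_num),
    ← Complex.exp_sub]
  congr 1
  rw [Real.log_div (by norm_num) (by norm_num), show (3125:ℝ) = 5^5 by norm_num,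
    show (6561:ℝ) = 3^8 by norm_num, Real.log_pow, Real.log_pow]
  push_cast; ring

lemma main_pos (a : ℂ) (ha : 0 < a.re) :
    appellF1 (2*a) (a + 1/2) (4*a - 1) (2*a + 1/2) (1/81) (1/6) =
      (3:ℂ) ^ (8*a) / ((2:ℂ) ^ (2*a) * (5:ℂ) ^ (5*a)) *
        (Real.sqrt Real.pi : ℂ) * Complex.Gamma (2*a + 1/2) / Complex.Gamma (a + 1/2) ^ 2 := by
  have h2a : 0 < (2*a).re := by simpa using ha
  have E := euler_int (2*a) (a + 1/2) (4*a-1) (1/81) (1/6) h2a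
    (by rw [abs_of_pos] <;> norm_num) (by rw [abs_of_pos] <;> norm_num)
  have S := subst_int a
  rw [← E, c0_pow, Complex.betaIntegral_eq_Gamma_mul_div _ _ ha (by norm_num),
    Complex.betaIntegral_eq_Gamma_mul_div _ _ h2a (by norm_num)] at S
  rw [show ((1/81 : ℝ) : ℂ) = 1/81 by push_cast; rfl,
    show ((1/6 : ℝ) : ℂ) = 1/6 by push_cast; rfl] at S
  have D := Complex.Gamma_mul_Gamma_add_half a
  rw [Complex.cpow_sub _ _ two_ne_zero, Complex.cpow_one] at D
  have g1 := Complex.Gamma_ne_zero_of_re_pos ha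
  have g2 := Complex.Gamma_ne_zero_of_re_pos h2a
  have g3 : Complex.Gamma (a + 1/2) ≠ 0 :=
    Complex.Gamma_ne_zero_of_re_pos (by simp; norm_num; linarith)
  have g4 : Complex.Gamma (2*a + 1/2) ≠ 0 :=
    Complex.Gamma_ne_zero_of_re_pos (by simp; norm_num; linarith)
  have g5 : Complex.Gamma (1/2) ≠ 0 := Complex.Gamma_ne_zero_of_re_pos (by norm_num)
  have g6 : (2:ℂ) ^ (2*a) ≠ 0 := by simp [Complex.cpow_eq_zero_iff]
  have g7 : (3:ℂ) ^ (8*a) ≠ 0 := by simp [Complex.cpow_eq_zero_iff]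
  have g8 : (5:ℂ) ^ (5*a) ≠ 0 := by simp [Complex.cpow_eq_zero_iff]
  generalize appellF1 (2*a) (a + 1/2) (4*a - 1) (2*a + 1/2) (1/81) (1/6) = F at *
  generalize Complex.Gamma (2*a + 1/2) = G4 at *
  generalize Complex.Gamma (a + 1/2) = G3 at *
  generalize Complex.Gamma (2*a) = G2 at *
  generalize Complex.Gamma a = G1 at *
  generalize Complex.Gamma (1/2) = G5 at *
  generalize (2:ℂ) ^ (2*a) = T at *
  generalize (3:ℂ) ^ (8*a) = U at *
  generalize (5:ℂ) ^ (5*a) = V at *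
  generalize (Real.sqrt Real.pi : ℂ) = P at *
  field_simp at S D ⊢
  have h2 : (2:ℂ) * G2 ≠ 0 := mul_ne_zero two_ne_zero g2
  apply mul_left_cancel₀ h2
  linear_combination (-G3 * T) * S + U * G4 * D

theorem stmt15 (a : ℂ) (ha : 0 ≤ a.re) :
    appellF1 (2*a) (a + 1/2) (4*a - 1) (2*a + 1/2) (1/81) (1/6) =
      (3:ℂ) ^ (8*a) / ((2:ℂ) ^ (2*a) * (5:ℂ) ^ (5*a)) *
        (Real.sqrt Real.pi : ℂ) * Complex.Gamma (2*a + 1/2) / Complex.Gamma (a + 1/2) ^ 2 := by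
  let s : ℕ → ℂ := fun n => a + ((1 / ((n:ℝ) + 1) : ℝ) : ℂ)
  have hs : Filter.Tendsto s Filter.atTop (nhds a) := by
    have h := (Complex.continuous_ofReal.tendsto 0).comp
      (tendsto_one_div_add_atTop_nhds_zero_nat (𝕜 := ℝ))
    have h2 := h.const_add a
    simpa [s, Function.comp_def] using h2
  have hre : ∀ n, 0 < (s n).re := by
    intro n
    have : (0:ℝ) < 1 / ((n:ℝ) + 1) := by positivity
    simp only [s, Complex.add_re, Complex.ofReal_re]
    linarith
  have hnorm : ∀ n, ‖s n‖ ≤ ‖a‖ + 1 := by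
    intro n
    refine (norm_add_le _ _).trans ?_
    have h0 : (0:ℝ) ≤ 1 / ((n:ℝ) + 1) := by positivity
    rw [Complex.norm_real, Real.norm_of_nonneg h0]
    have : 1 / ((n:ℝ) + 1) ≤ 1 := by
      rw [div_le_one (by positivity)]
      have : (0:ℝ) ≤ n := by positivity
      linarith
    linarith
  have hs' : Filter.Tendsto s Filter.atTop
      (nhdsWithin a {a' | 0 ≤ a'.re ∧ ‖a'‖ ≤ ‖a‖ + 1}) :=
    tendsto_nhdsWithin_iff.2 ⟨hs, .of_forall fun n => ⟨(hre n).le, hnorm n⟩⟩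
  have hL := (cont_lhs (‖a‖ + 1) a ⟨ha, by linarith⟩).tendsto.comp hs'
  have c1 : ContinuousAt (fun z : ℂ => Complex.Gamma (2*z + 1/2)) a := by
    refine ContinuousAt.comp (g := Complex.Gamma) (f := fun z : ℂ => 2*z + 1/2) ?_ (by fun_prop)
    refine (Complex.differentiableAt_Gamma _ fun m h => ?_).continuousAt
    have := congrArg Complex.re h
    simp at this
    norm_num at this
    have : (0:ℝ) ≤ m := by positivity
    linarith
  have c2 : ContinuousAt (fun z : ℂ => Complex.Gamma (z + 1/2)) a := by
    refine ContinuousAt.comp (g := Complex.Gamma) (f := fun z : ℂ => z + 1/2) ?_ (by fun_prop)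
    refine (Complex.differentiableAt_Gamma _ fun m h => ?_).continuousAt
    have := congrArg Complex.re h
    simp at this
    norm_num at this
    have : (0:ℝ) ≤ m := by positivity
    linarith
  have g3 : Complex.Gamma (a + 1/2) ≠ 0 :=
    Complex.Gamma_ne_zero_of_re_pos (by simp; norm_num; linarith)
  have cp : ∀ (b k : ℂ), b ≠ 0 → ContinuousAt (fun z : ℂ => b ^ (k * z)) a := fun b k hb =>
    ContinuousAt.const_cpow (by fun_prop) (Or.inl hb)
  have hR : ContinuousAt (fun a : ℂ => (3:ℂ) ^ (8*a) / ((2:ℂ) ^ (2*a) * (5:ℂ) ^ (5*a)) *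
        (Real.sqrt Real.pi : ℂ) * Complex.Gamma (2*a + 1/2) / Complex.Gamma (a + 1/2) ^ 2) a := by
    refine ContinuousAt.div (ContinuousAt.mul (ContinuousAt.mul (ContinuousAt.div
      (cp 3 8 (by norm_num)) ((cp 2 2 (by norm_num)).mul (cp 5 5 (by norm_num))) ?_)
      continuousAt_const) c1) (c2.pow 2) (pow_ne_zero 2 g3)
    simp [Complex.cpow_eq_zero_iff]
  refine tendsto_nhds_unique hL ((hR.tendsto.comp hs).congr fun n => ?_)
  exact (main_pos (s n) (hre n)).symm
end
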